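/- Let α, β, γ, δ be distinct elements of {1,…,n} and λ₁, λ₂, μ₁, μ₂ ∈ Z. Set g₁ = (α β)⁺_{λ₁}(γ δ)⁺_{λ₂}, g₂ = (α β)⁺_{λ₁}(γ δ)⁻_{λ₂}, g₃ = (α β)⁻_{λ₁}(γ δ)⁻_{λ₂}, h₁ = (α γ)⁺_{μ₁}(β δ)⁺_{μ₂}, h₂ = (α γ)⁺_{μ₁}(β δ)⁻_{μ₂}, h₃ = (α γ)⁻_{μ₁}(β δ)⁻_{μ₂} in G_n. Then: (i) g₁ commutes with h₁ iff μ₁ − λ₁ = μ₂ − λ₂; (ii) g₁ never commutes with h₂; (iii) g₁ commutes with h₃ iff μ₁ − λ₁ = μ₂ + λ₂; (iv) g₂ commutes with h₂ iff μ₁ − λ₁ = μ₂ − λ₂; (v) g₂ never commutes with h₃; (vi) g₃ commutes with h₃ iff μ₁ − λ₁ = λ₂ − μ₂. -/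

import Mathlib

/-!
Common setup: the affine Weyl group of type C̃ₙ, realized as the semidirect
product of the group Wₙ of signed permutations of {1,…,n} with the translation
lattice ℤⁿ.  An element is a triple `(π, s, v)`, where `π` is the underlying
permutation of the n points, `s i` is the sign attached to the point `i`
(so the signed permutation maps the point `i` to the point `π i` with sign `s i`),
and `v ∈ ℤⁿ` is the translation part.  The multiplication realizes
`(α,v)(τ,u) = (ατ, vᵗ + u)`.
-/

/-- An element of the affine Weyl group of type C̃ₙ: a signed permutation
`(π, s)` together with a translation vector `v ∈ ℤⁿ`. -/
@[ext]
structure AffineWeylC (n : ℕ) where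
  π : Equiv.Perm (Fin n)
  s : Fin n → ℤˣ
  v : Fin n → ℤ

namespace AffineWeylC

variable {n : ℕ}

instance : One (AffineWeylC n) := ⟨⟨1, 1, 0⟩⟩

instance : Mul (AffineWeylC n) :=
  ⟨fun g h => ⟨h.π * g.π, fun j => g.s j * h.s (g.π j),
    fun i => (h.s (h.π⁻¹ i) : ℤ) * g.v (h.π⁻¹ i) + h.v i⟩⟩

instance : Inv (AffineWeylC n) :=
  ⟨fun g => ⟨g.π⁻¹, fun k => (g.s (g.π⁻¹ k))⁻¹,
    fun i => -(((g.s i)⁻¹ : ℤˣ) : ℤ) * g.v (g.π i)⟩⟩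

@[simp] lemma mul_π (g h : AffineWeylC n) : (g * h).π = h.π * g.π := rfl
@[simp] lemma mul_s (g h : AffineWeylC n) (j : Fin n) :
    (g * h).s j = g.s j * h.s (g.π j) := rfl
@[simp] lemma mul_v (g h : AffineWeylC n) (i : Fin n) :
    (g * h).v i = (h.s (h.π⁻¹ i) : ℤ) * g.v (h.π⁻¹ i) + h.v i := rfl
@[simp] lemma one_π : (1 : AffineWeylC n).π = 1 := rfl
@[simp] lemma one_s (j : Fin n) : (1 : AffineWeylC n).s j = 1 := rfl
@[simp] lemma one_v (i : Fin n) : (1 : AffineWeylC n).v i = 0 := rfl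
@[simp] lemma inv_π (g : AffineWeylC n) : g⁻¹.π = g.π⁻¹ := rfl
@[simp] lemma inv_s (g : AffineWeylC n) (k : Fin n) :
    g⁻¹.s k = (g.s (g.π⁻¹ k))⁻¹ := rfl
@[simp] lemma inv_v (g : AffineWeylC n) (i : Fin n) :
    g⁻¹.v i = -(((g.s i)⁻¹ : ℤˣ) : ℤ) * g.v (g.π i) := rfl

instance : Group (AffineWeylC n) where
  mul_assoc a b c := by
    refine AffineWeylC.ext ?_ (funext fun j => ?_) (funext fun i => ?_)
    · simp [mul_assoc]
    · simp only [mul_s, mul_π, Equiv.Perm.mul_apply]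
      rw [mul_assoc]
    · simp only [mul_v, mul_s, mul_π, mul_inv_rev, Equiv.Perm.mul_apply,
        show ∀ (f : Equiv.Perm (Fin n)) (x : Fin n), f (f⁻¹ x) = x from
          fun f x => Equiv.apply_symm_apply f x, Units.val_mul]
      ring
  one_mul a := by
    refine AffineWeylC.ext ?_ (funext fun j => ?_) (funext fun i => ?_) <;>
      simp
  mul_one a := by
    refine AffineWeylC.ext ?_ (funext fun j => ?_) (funext fun i => ?_) <;>
      simp
  inv_mul_cancel a := by
    refine AffineWeylC.ext ?_ (funext fun j => ?_) (funext fun i => ?_)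
    · simp
    · simp
    · simp only [mul_v, inv_v, inv_s, one_v,
        show ∀ (f : Equiv.Perm (Fin n)) (x : Fin n), f (f⁻¹ x) = x from
          fun f x => Equiv.apply_symm_apply f x]
      have h1 : ((a.s (a.π⁻¹ i) : ℤ)) * (((a.s (a.π⁻¹ i))⁻¹ : ℤˣ) : ℤ) = 1 := by
        rw [← Units.val_mul, mul_inv_cancel, Units.val_one]
      linear_combination (-(a.v i)) * h1

/-- `g` is an involution: a non-identity element squaring to the identity. -/
def Involution (g : AffineWeylC n) : Prop := g ≠ 1 ∧ g * g = 1

/-- The conjugacy class of `a`. -/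
def conjClass (a : AffineWeylC n) : Set (AffineWeylC n) := {b | IsConj a b}

/-- The number of transpositions (2-cycles) of the underlying signed permutation. -/
noncomputable def numTrans (g : AffineWeylC n) : ℕ :=
  {i : Fin n | g.π i ≠ i}.ncard / 2

/-- The number of negative 1-cycles of `g` carrying an even label. -/
noncomputable def numNegEven (g : AffineWeylC n) : ℕ :=
  {i : Fin n | g.π i = i ∧ g.s i = -1 ∧ Even (g.v i)}.ncard

/-- The number of negative 1-cycles of `g` carrying an odd label. -/
noncomputable def numNegOdd (g : AffineWeylC n) : ℕ :=
  {i : Fin n | g.π i = i ∧ g.s i = -1 ∧ Odd (g.v i)}.ncard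

/-- The number of positive 1-cycles (fixed points) of `g`. -/
noncomputable def numPos (g : AffineWeylC n) : ℕ :=
  {i : Fin n | g.π i = i ∧ g.s i = 1}.ncard

/-- The labelled cycle type `(m, k_e, k_o, l)` of an involution. -/
noncomputable def cycleType (g : AffineWeylC n) : ℕ × ℕ × ℕ × ℕ :=
  (numTrans g, numNegEven g, numNegOdd g, numPos g)

/-- `g` has labelled cycle type `(m, k_e, k_o, l)`. -/
def HasType (g : AffineWeylC n) (m ke ko l : ℕ) : Prop :=
  numTrans g = m ∧ numNegEven g = ke ∧ numNegOdd g = ko ∧ numPos g = l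

/-- The canonical class representative
`a_{m,k_e,k_o,l} = (1 2)⁺₀ ⋯ (2m−1 2m)⁺₀ (2m+1)⁻₀ ⋯ (2m+k_e)⁻₀
(2m+k_e+1)⁻₁ ⋯ (n−l)⁻₁ (n−l+1)⁺₀ ⋯ (n)⁺₀`
(here written with 0-based indices): points `0,…,2m-1` are paired off into
label‑0 positive transpositions, points `2m,…,2m+k_e-1` are negative 1-cycles
with label 0, points `2m+k_e,…,2m+k_e+k_o-1` are negative 1-cycles with label 1,
and the remaining `l` points are positive fixed points with label 0. -/
def IsCanon (a : AffineWeylC n) (m ke ko l : ℕ) : Prop :=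
  2*m + ke + ko + l = n ∧
  (∀ i : Fin n, i.val < 2*m → i.val % 2 = 0 → (a.π i).val = i.val + 1) ∧
  (∀ i : Fin n, i.val < 2*m → i.val % 2 = 1 → (a.π i).val = i.val - 1) ∧
  (∀ i : Fin n, 2*m ≤ i.val → a.π i = i) ∧
  (∀ i : Fin n, i.val < 2*m → a.s i = 1 ∧ a.v i = 0) ∧
  (∀ i : Fin n, 2*m ≤ i.val → i.val < 2*m + ke → a.s i = -1 ∧ a.v i = 0) ∧
  (∀ i : Fin n, 2*m + ke ≤ i.val → i.val < 2*m + ke + ko → a.s i = -1 ∧ a.v i = 1) ∧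
  (∀ i : Fin n, 2*m + ke + ko ≤ i.val → a.s i = 1 ∧ a.v i = 0)

/-- The labelled positive transposition `(α β)⁺_λ`. -/
def posTrans (α β : Fin n) (lam : ℤ) : AffineWeylC n :=
  ⟨Equiv.swap α β, 1, fun i => if i = α then lam else if i = β then -lam else 0⟩

/-- The labelled negative transposition `(α β)⁻_λ`. -/
def negTrans (α β : Fin n) (lam : ℤ) : AffineWeylC n :=
  ⟨Equiv.swap α β, fun i => if i = α then -1 else if i = β then -1 else 1,
    fun i => if i = α then lam else if i = β then lam else 0⟩

/-- The labelled negative 1-cycle `(α)⁻_λ`. -/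
def negOne (α : Fin n) (lam : ℤ) : AffineWeylC n :=
  ⟨1, fun i => if i = α then -1 else 1, fun i => if i = α then lam else 0⟩

/-- The finite Weyl group Wₙ of type Cₙ, as the subgroup of the affine Weyl
group consisting of the elements with trivial translation part. -/
def WeylSub (n : ℕ) : Subgroup (AffineWeylC n) where
  carrier := {g | g.v = 0}
  one_mem' := rfl
  mul_mem' := by
    intro g h hg hh
    show (g * h).v = 0
    funext i
    simp only [mul_v]
    rw [show g.v = 0 from hg, show h.v = 0 from hh]
    simp
  inv_mem' := by
    intro g hg
    show g⁻¹.v = 0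
    funext i
    simp only [inv_v]
    rw [show g.v = 0 from hg]
    simp

/-- The projection `G_n → W_n`, `(σ, v) ↦ σ`. -/
def weylPart (n : ℕ) : AffineWeylC n →* WeylSub n where
  toFun g := ⟨⟨g.π, g.s, 0⟩, rfl⟩
  map_one' := by
    apply Subtype.ext
    refine AffineWeylC.ext rfl rfl rfl
  map_mul' g h := by
    apply Subtype.ext
    refine AffineWeylC.ext rfl rfl (funext fun i => ?_)
    simp

end AffineWeylC

/-- The commuting graph on a subset `X` of a group: the vertices are the
elements of `X`, and distinct vertices are adjacent iff they commute. -/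
def commGraph {G : Type*} [Group G] (X : Set G) : SimpleGraph X where
  Adj x y := (x : G) ≠ (y : G) ∧ Commute (x : G) (y : G)
  symm := ⟨fun _ _ h => ⟨fun e => h.1 e.symm, h.2.symm⟩⟩
  loopless := ⟨fun _ h => h.1 rfl⟩

namespace AffineWeylC

variable {n : ℕ}

lemma commute_iff (g h : AffineWeylC n) :
    Commute g h ↔ ∀ i, h.π (g.π i) = g.π (h.π i) ∧
      g.s i * h.s (g.π i) = h.s i * g.s (h.π i) ∧
      (h.s (h.π⁻¹ i) : ℤ) * g.v (h.π⁻¹ i) + h.v i =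
        (g.s (g.π⁻¹ i) : ℤ) * h.v (g.π⁻¹ i) + g.v i := by
  refine ⟨fun hc i => ⟨?_, ?_, ?_⟩, fun hc => AffineWeylC.ext ?_ ?_ ?_⟩
  · exact congrArg (fun x : AffineWeylC n => x.π i) hc.eq
  · exact congrArg (fun x : AffineWeylC n => x.s i) hc.eq
  · exact congrArg (fun x : AffineWeylC n => x.v i) hc.eq
  · exact Equiv.ext fun i => (hc i).1
  · exact funext fun i => (hc i).2.1
  · exact funext fun i => (hc i).2.2

lemma forall_iff_of_four_points {α β γ δ : Fin n} {P : Fin n → Prop}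
    (hP : ∀ i, i ≠ α → i ≠ β → i ≠ γ → i ≠ δ → P i) :
    (∀ i, P i) ↔ P α ∧ P β ∧ P γ ∧ P δ := by
  refine ⟨fun h => ⟨h α, h β, h γ, h δ⟩, fun ⟨ha, hb, hc, hd⟩ i => ?_⟩
  by_cases hα : i = α
  · exact hα ▸ ha
  by_cases hβ : i = β
  · exact hβ ▸ hb
  by_cases hγ : i = γ
  · exact hγ ▸ hc
  by_cases hδ : i = δ
  · exact hδ ▸ hd
  exact hP i hα hβ hγ hδ

end AffineWeylC

/-- Commuting criteria for products of two labelled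
transpositions on four distinct points. -/
theorem stmt_8 (n : ℕ) (α β γ δ : Fin n)
    (h1 : α ≠ β) (h2 : α ≠ γ) (h3 : α ≠ δ) (h4 : β ≠ γ) (h5 : β ≠ δ) (h6 : γ ≠ δ)
    (lam1 lam2 mu1 mu2 : ℤ) :
    (Commute (AffineWeylC.posTrans α β lam1 * AffineWeylC.posTrans γ δ lam2)
        (AffineWeylC.posTrans α γ mu1 * AffineWeylC.posTrans β δ mu2) ↔
      mu1 - lam1 = mu2 - lam2) ∧
    ¬ Commute (AffineWeylC.posTrans α β lam1 * AffineWeylC.posTrans γ δ lam2)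
        (AffineWeylC.posTrans α γ mu1 * AffineWeylC.negTrans β δ mu2) ∧
    (Commute (AffineWeylC.posTrans α β lam1 * AffineWeylC.posTrans γ δ lam2)
        (AffineWeylC.negTrans α γ mu1 * AffineWeylC.negTrans β δ mu2) ↔
      mu1 - lam1 = mu2 + lam2) ∧
    (Commute (AffineWeylC.posTrans α β lam1 * AffineWeylC.negTrans γ δ lam2)
        (AffineWeylC.posTrans α γ mu1 * AffineWeylC.negTrans β δ mu2) ↔
      mu1 - lam1 = mu2 - lam2) ∧
    ¬ Commute (AffineWeylC.posTrans α β lam1 * AffineWeylC.negTrans γ δ lam2)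
        (AffineWeylC.negTrans α γ mu1 * AffineWeylC.negTrans β δ mu2) ∧
    (Commute (AffineWeylC.negTrans α β lam1 * AffineWeylC.negTrans γ δ lam2)
        (AffineWeylC.negTrans α γ mu1 * AffineWeylC.negTrans β δ mu2) ↔
      mu1 - lam1 = lam2 - mu2) := by
  refine ⟨?_, ?_, ?_, ?_, ?_, ?_⟩ <;>
  · rw [AffineWeylC.commute_iff,
      AffineWeylC.forall_iff_of_four_points (α := α) (β := β) (γ := γ) (δ := δ)
        (fun i ha hb hc hd => by
          simp [AffineWeylC.posTrans, AffineWeylC.negTrans, Equiv.swap_apply_def,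
            ha, hb, hc, hd])]
    simp [AffineWeylC.posTrans, AffineWeylC.negTrans, Equiv.swap_apply_def,
      h1, h2, h3, h4, h5, h6, h1.symm, h2.symm, h3.symm, h4.symm, h5.symm, h6.symm]
    try omega
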